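/- arXiv:1804.01651 — 2 statements merged into one kernel-verified Lean document; each statement's English description precedes it below -/
import Mathlib

section
/- (Gauss) For a complex number q with |q| < 1, the quotient (q;q)_∞ / (-q;q)_∞ equals the bilateral theta sum Σ_{k=-∞}^{∞} (-1)^k q^{k²}, which converges absolutely. -/
/-- The infinite q-Pochhammer symbol `(a;q)_∞ = ∏_{k=0}^∞ (1 - a q^k)`. -/
noncomputable def qPochInf (a q : ℂ) : ℂ := ∏' k : ℕ, (1 - a * q ^ k)

open Filter Topology

/-- The finite quotient `(q;q)_n / (-q;q)_n`. -/
noncomputable def qPochQuot (q : ℂ) (n : ℕ) : ℂ :=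
  ∏ j ∈ Finset.range n, (1 - q ^ (j + 1)) / (1 + q ^ (j + 1))

/-- The summands of the finite form of the Gauss identity due to Shanks. -/
noncomputable def shanksTerm (q : ℂ) (n s : ℕ) : ℂ :=
  (-1) ^ s * (qPochQuot q n / qPochQuot q s) * q ^ (s * n) * (2 * q ^ s / (1 + q ^ s))

lemma norm_pow_succ_lt_one {q : ℂ} (hq : ‖q‖ < 1) (n : ℕ) : ‖q ^ (n + 1)‖ < 1 := by
  rw [norm_pow]
  exact pow_lt_one₀ (norm_nonneg _) hq n.succ_ne_zero

lemma one_sub_pow_succ_ne_zero {q : ℂ} (hq : ‖q‖ < 1) (n : ℕ) : 1 - q ^ (n + 1) ≠ 0 := by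
  intro h
  have := norm_pow_succ_lt_one hq n
  rw [← sub_eq_zero.mp h] at this
  simp at this

lemma one_add_pow_succ_ne_zero {q : ℂ} (hq : ‖q‖ < 1) (n : ℕ) : 1 + q ^ (n + 1) ≠ 0 := by
  intro h
  have := norm_pow_succ_lt_one hq n
  rw [← neg_eq_of_add_eq_zero_right h] at this
  simp at this

lemma qPochQuot_ne_zero {q : ℂ} (hq : ‖q‖ < 1) (n : ℕ) : qPochQuot q n ≠ 0 :=
  Finset.prod_ne_zero_iff.mpr fun j _ =>
    div_ne_zero (one_sub_pow_succ_ne_zero hq j) (one_add_pow_succ_ne_zero hq j)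

lemma qPochQuot_succ (q : ℂ) (n : ℕ) :
    qPochQuot q (n + 1) = qPochQuot q n * ((1 - q ^ (n + 1)) / (1 + q ^ (n + 1))) :=
  Finset.prod_range_succ _ _

lemma shanksTerm_zero {q : ℂ} (n : ℕ) : shanksTerm q n 0 = qPochQuot q n := by
  simp [shanksTerm, qPochQuot]
  norm_num

lemma sum_shanksTerm_sub {q : ℂ} (hq : ‖q‖ < 1) (n m : ℕ) :
    ∑ s ∈ Finset.range (m + 1), (shanksTerm q (n + 1) s - shanksTerm q n s) =
      -((-1) ^ m * (qPochQuot q n / qPochQuot q m) *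
        (2 * q ^ ((m + 1) * (n + 1)) / (1 + q ^ (n + 1)))) := by
  have hx := one_add_pow_succ_ne_zero hq n
  induction m with
  | zero =>
    simp only [zero_add, Finset.sum_range_one, shanksTerm_zero, qPochQuot_succ, one_mul]
    simp only [qPochQuot, Finset.prod_range_zero]
    field_simp
    ring
  | succ m ih =>
    rw [Finset.sum_range_succ, ih]
    have hy := one_add_pow_succ_ne_zero hq m
    have hy' := one_sub_pow_succ_ne_zero hq m
    have hP := qPochQuot_ne_zero hq m
    have e1 : q ^ ((m + 1) * (n + 1)) = q ^ ((m + 1) * n) * q ^ (m + 1) := by ring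
    have e2 : q ^ ((m + 1 + 1) * (n + 1)) = q ^ ((m + 1) * n) * q ^ (m + 1) * q ^ (n + 1) := by
      ring
    simp only [shanksTerm, qPochQuot_succ, e1, e2, pow_succ (-1 : ℂ) m]
    generalize q ^ ((m + 1) * n) = a
    generalize q ^ (m + 1) = y at *
    generalize q ^ (n + 1) = x at *
    field_simp
    ring

/-- The finite form of the Gauss identity due to Shanks. -/
lemma sum_shanksTerm {q : ℂ} (hq : ‖q‖ < 1) (n : ℕ) :
    ∑ s ∈ Finset.range (n + 1), shanksTerm q n s =
      1 + ∑ k ∈ Finset.range n, 2 * ((-1) ^ (k + 1) * q ^ ((k + 1) ^ 2)) := by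
  induction n with
  | zero => simp [shanksTerm_zero, qPochQuot]
  | succ n ih =>
    have h := sum_shanksTerm_sub hq n n
    rw [Finset.sum_sub_distrib, sub_eq_iff_eq_add, ih] at h
    rw [Finset.sum_range_succ, h, Finset.sum_range_succ]
    have hx := one_add_pow_succ_ne_zero hq n
    have e : q ^ ((n + 1) * (n + 1)) = q ^ ((n + 1) ^ 2) := by ring
    rw [shanksTerm, div_self (qPochQuot_ne_zero hq _), div_self (qPochQuot_ne_zero hq _), e]
    field_simp
    ring

lemma summable_norm_pow_succ {q : ℂ} (hq : ‖q‖ < 1) : Summable fun k : ℕ => ‖q ^ (k + 1)‖ := by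
  simp_rw [norm_pow]
  exact (summable_nat_add_iff 1).mpr (summable_geometric_of_lt_one (norm_nonneg q) hq)

lemma qPochInf_self (q : ℂ) : qPochInf q q = ∏' k : ℕ, (1 + -q ^ (k + 1)) := by
  simp only [qPochInf, pow_succ', sub_eq_add_neg]

lemma qPochInf_neg (q : ℂ) : qPochInf (-q) q = ∏' k : ℕ, (1 + q ^ (k + 1)) := by
  simp only [qPochInf, pow_succ', neg_mul, sub_neg_eq_add]

lemma qPochInf_self_ne_zero {q : ℂ} (hq : ‖q‖ < 1) : qPochInf q q ≠ 0 := by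
  rw [qPochInf_self]
  refine tprod_one_add_ne_zero_of_summable (fun k => ?_) ?_
  · simpa [sub_eq_add_neg] using one_sub_pow_succ_ne_zero hq k
  · simpa only [norm_neg] using summable_norm_pow_succ hq

lemma qPochInf_neg_ne_zero {q : ℂ} (hq : ‖q‖ < 1) : qPochInf (-q) q ≠ 0 := by
  rw [qPochInf_neg]
  exact tprod_one_add_ne_zero_of_summable (one_add_pow_succ_ne_zero hq) (summable_norm_pow_succ hq)

lemma tendsto_qPochQuot {q : ℂ} (hq : ‖q‖ < 1) :
    Tendsto (qPochQuot q) atTop (𝓝 (qPochInf q q / qPochInf (-q) q)) := by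
  have h1 : Multipliable fun k : ℕ => 1 + -q ^ (k + 1) :=
    multipliable_one_add_of_summable (by simpa only [norm_neg] using summable_norm_pow_succ hq)
  have h2 : Multipliable fun k : ℕ => 1 + q ^ (k + 1) :=
    multipliable_one_add_of_summable (summable_norm_pow_succ hq)
  have h := h1.hasProd.tendsto_prod_nat.div h2.hasProd.tendsto_prod_nat
    (qPochInf_neg q ▸ qPochInf_neg_ne_zero hq)
  rw [← qPochInf_self, ← qPochInf_neg] at h
  refine h.congr fun n => ?_
  simp [qPochQuot, Finset.prod_div_distrib, sub_eq_add_neg]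

lemma exists_norm_shanksTerm_le {q : ℂ} (hq : ‖q‖ < 1) :
    ∃ C, ∀ n s, ‖shanksTerm q n (s + 1)‖ ≤ C * ‖q‖ ^ n := by
  have hP := tendsto_qPochQuot hq
  obtain ⟨A, hA⟩ := (Metric.isBounded_range_of_tendsto _ hP).exists_norm_le
  obtain ⟨B, hB⟩ := (Metric.isBounded_range_of_tendsto _ (hP.inv₀ (div_ne_zero
    (qPochInf_self_ne_zero hq) (qPochInf_neg_ne_zero hq)))).exists_norm_le
  have hA' (n) : ‖qPochQuot q n‖ ≤ A := hA _ ⟨n, rfl⟩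
  have hB' (n) : ‖(qPochQuot q n)⁻¹‖ ≤ B := hB _ ⟨n, rfl⟩
  have hA0 : 0 ≤ A := (norm_nonneg _).trans (hA' 0)
  have hB0 : 0 ≤ B := (norm_nonneg _).trans (hB' 0)
  refine ⟨A * B * (2 / (1 - ‖q‖)), fun n s => ?_⟩
  have hq' : 0 < 1 - ‖q‖ := sub_pos.mpr hq
  have hle : ‖q‖ ^ (s + 1) ≤ ‖q‖ := pow_le_of_le_one (norm_nonneg _) hq.le s.succ_ne_zero
  have hden : 1 - ‖q‖ ≤ ‖1 + q ^ (s + 1)‖ := by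
    have := norm_sub_norm_le (1 : ℂ) (-q ^ (s + 1))
    rw [sub_neg_eq_add, norm_neg, norm_one, norm_pow] at this
    linarith
  have hfrac : ‖2 * q ^ (s + 1) / (1 + q ^ (s + 1))‖ ≤ 2 / (1 - ‖q‖) := by
    rw [norm_div, norm_mul, norm_pow, Complex.norm_ofNat]
    gcongr
    linarith
  have hpow : ‖q ^ ((s + 1) * n)‖ ≤ ‖q‖ ^ n := by
    rw [norm_pow]
    exact pow_le_pow_of_le_one (norm_nonneg _) hq.le (Nat.le_mul_of_pos_left n s.succ_pos)
  calc ‖shanksTerm q n (s + 1)‖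
      = ‖qPochQuot q n‖ * ‖(qPochQuot q (s + 1))⁻¹‖ * ‖q ^ ((s + 1) * n)‖ *
          ‖2 * q ^ (s + 1) / (1 + q ^ (s + 1))‖ := by
        simp only [shanksTerm, div_eq_mul_inv (qPochQuot q n), norm_mul, norm_pow, norm_neg,
          norm_one, one_pow, one_mul]
    _ ≤ A * B * ‖q‖ ^ n * (2 / (1 - ‖q‖)) := by
        gcongr
        exacts [hA' n, hB' _]
    _ = _ := by ring

lemma tendsto_sum_shanksTerm {q : ℂ} (hq : ‖q‖ < 1) :
    Tendsto (fun n => ∑ s ∈ Finset.range (n + 1), shanksTerm q n s) atTop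
      (𝓝 (qPochInf q q / qPochInf (-q) q)) := by
  obtain ⟨C, hC⟩ := exists_norm_shanksTerm_le hq
  have htail : Tendsto (fun n => ∑ s ∈ Finset.range n, shanksTerm q n (s + 1)) atTop (𝓝 0) := by
    refine squeeze_zero_norm (a := fun n : ℕ => C * (n * ‖q‖ ^ n)) (fun n => ?_) ?_
    · refine (norm_sum_le_of_le _ fun s _ => hC n s).trans_eq ?_
      rw [Finset.sum_const, Finset.card_range, nsmul_eq_mul]
      ring
    · simpa using (tendsto_self_mul_const_pow_of_lt_one (norm_nonneg q) hq).const_mul C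
  have h := htail.add (tendsto_qPochQuot hq)
  rw [zero_add] at h
  refine h.congr fun n => ?_
  rw [Finset.sum_range_succ', shanksTerm_zero]

lemma summable_norm_theta_nat {q : ℂ} (hq : ‖q‖ < 1) :
    Summable fun k : ℕ => ‖(-1 : ℂ) ^ k * q ^ (k ^ 2)‖ := by
  refine (summable_geometric_of_lt_one (norm_nonneg q) hq).of_nonneg_of_le
    (fun _ => norm_nonneg _) fun k => ?_
  rw [norm_mul, norm_pow, norm_neg, norm_one, one_pow, one_mul, norm_pow]
  exact pow_le_pow_of_le_one (norm_nonneg _) hq.le (Nat.le_self_pow two_ne_zero k)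

lemma theta_term_natCast (q : ℂ) (k : ℕ) :
    (-1 : ℂ) ^ (k : ℤ) * q ^ ((k : ℤ) ^ 2) = (-1) ^ k * q ^ (k ^ 2) := by
  norm_cast

lemma theta_term_neg (q : ℂ) (k : ℤ) :
    (-1 : ℂ) ^ (-k) * q ^ ((-k) ^ 2) = (-1) ^ k * q ^ (k ^ 2) := by
  rw [neg_sq, zpow_neg, ← inv_zpow, inv_neg_one]

/-- Gauss: for `|q| < 1`, `(q;q)_∞ / (-q;q)_∞ = Σ_{k=-∞}^∞ (-1)^k q^{k²}`,
the bilateral series converging absolutely. -/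
theorem gauss_theta2 (q : ℂ) (hq : ‖q‖ < 1) :
    Summable (fun k : ℤ => ‖(-1 : ℂ) ^ k * q ^ (k ^ 2)‖) ∧
    qPochInf q q / qPochInf (-q) q = ∑' k : ℤ, (-1 : ℂ) ^ k * q ^ (k ^ 2) := by
  have hnat := summable_norm_theta_nat hq
  have hpos : Summable fun k : ℕ => ‖(-1 : ℂ) ^ (k : ℤ) * q ^ ((k : ℤ) ^ 2)‖ := by
    simpa only [theta_term_natCast] using hnat
  have hneg : Summable fun k : ℕ => ‖(-1 : ℂ) ^ (-(k : ℤ)) * q ^ ((-(k : ℤ)) ^ 2)‖ := by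
    simpa only [theta_term_neg] using hpos
  refine ⟨Summable.of_nat_of_neg hpos hneg, ?_⟩
  have hshift := (summable_nat_add_iff 1).mpr hnat.of_norm
  have hlim := (hshift.hasSum.mul_left 2).tendsto_sum_nat.const_add 1
  rw [tendsto_nhds_unique (tendsto_sum_shanksTerm hq)
      (hlim.congr fun n => (sum_shanksTerm hq n).symm),
    Summable.tsum_of_nat_of_neg (f := fun k : ℤ => (-1 : ℂ) ^ k * q ^ (k ^ 2))
      hpos.of_norm hneg.of_norm]
  simp only [theta_term_neg, theta_term_natCast]
  rw [hnat.of_norm.tsum_eq_zero_add]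
  simp
  ring
end

section
/- (Alladi's multi-dimensional Sylvester identity, Theorem 1.1) Let r ≥ 1 be an integer, let q ∈ ℂ with |q| < 1, and let a_1, …, a_r ∈ ℂ. Then ∏_{j=1}^{r} (-a_j q;q)_∞ = 1 + Σ_{N=1}^∞ q^{N²} [∏_{j=1}^{r} (-a_j q;q)_{N-1}] · Σ_{i_1+⋯+i_r=N, i_t ≥ 0} [a_1^{i_1}⋯a_r^{i_r} q^{C(i_1,2)+⋯+C(i_r,2)} / ((q;q)_{i_1}⋯(q;q)_{i_r})] · (1 + Σ_{s=1}^{r} q^{i_1+i_2+⋯+i_s} a_s q^N ∏_{k=1}^{s-1} (1 + a_k q^N)), where the inner sum ranges over all r-tuples (i_1,…,i_r) of nonnegative integers summing to N, C(i,2) = i(i-1)/2 denotes the binomial coefficient, and the outer series converges absolutely. -/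
/-- The finite q-Pochhammer symbol `(a;q)_n = ∏_{k=0}^{n-1} (1 - a q^k)`. -/
noncomputable def qPoch (a q : ℂ) (n : ℕ) : ℂ := ∏ k ∈ Finset.range n, (1 - a * q ^ k)

/-- The `N`-th summand in Alladi's multi-dimensional Sylvester identity. -/
noncomputable def alladiTerm (r : ℕ) (q : ℂ) (a : Fin r → ℂ) (N : ℕ) : ℂ :=
  q ^ (N ^ 2) * (∏ j : Fin r, qPoch (-a j * q) q (N - 1)) *
    ∑ i ∈ Finset.Nat.antidiagonalTuple r N,
      ((∏ t : Fin r, a t ^ i t) * q ^ (∑ t : Fin r, Nat.choose (i t) 2) /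
          ∏ t : Fin r, qPoch q q (i t)) *
        (1 + ∑ s : Fin r, q ^ (∑ t ∈ Finset.Iic s, i t) * a s * q ^ N *
            ∏ k ∈ Finset.Iio s, (1 + a k * q ^ N))

open Finset Filter Topology

/-- The power series `∑ a^i q^{C(i,2)} X^i / (q;q)_i`, which by Euler is `(-aX;q)_∞`. -/
noncomputable def eulerSeries (a q : ℂ) : PowerSeries ℂ :=
  PowerSeries.mk fun i => a ^ i * q ^ i.choose 2 / qPoch q q i

/-- The product of the series `(-a_t X;q)_∞`, with `a_t` replaced by `q a_t` for `t < s`. -/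
noncomputable def shiftedProd {r : ℕ} (a : Fin r → ℂ) (q : ℂ) (s : ℕ) : PowerSeries ℂ :=
  ∏ t : Fin r, eulerSeries (if t.val < s then q * a t else a t) q

/-- The partial product `∏_{k < s} (1 + a_k x)`. -/
noncomputable def partialProd {r : ℕ} (a : Fin r → ℂ) (x : ℂ) (s : ℕ) : ℂ :=
  ∏ k : Fin r, if k.val < s then 1 + a k * x else 1

theorem qPoch_succ (a q : ℂ) (n : ℕ) : qPoch a q (n + 1) = qPoch a q n * (1 - a * q ^ n) := by
  simp [qPoch, prod_range_succ]

theorem one_sub_norm_le {q : ℂ} (hq : ‖q‖ < 1) (n : ℕ) : 1 - ‖q‖ ≤ ‖1 - q * q ^ n‖ := by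
  have h1 : ‖q * q ^ n‖ ≤ ‖q‖ := by
    rw [norm_mul, norm_pow]
    exact mul_le_of_le_one_right (norm_nonneg q) (pow_le_one₀ (norm_nonneg q) hq.le)
  have h2 := norm_sub_norm_le (1 : ℂ) (q * q ^ n)
  rw [norm_one] at h2
  linarith

theorem one_sub_mul_pow_ne_zero {q : ℂ} (hq : ‖q‖ < 1) (n : ℕ) : 1 - q * q ^ n ≠ 0 :=
  norm_pos_iff.1 (lt_of_lt_of_le (sub_pos.2 hq) (one_sub_norm_le hq n))

theorem qPoch_self_ne_zero {q : ℂ} (hq : ‖q‖ < 1) (n : ℕ) : qPoch q q n ≠ 0 :=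
  prod_ne_zero_iff.2 fun k _ => one_sub_mul_pow_ne_zero hq k

theorem pow_le_norm_qPoch_self {q : ℂ} (hq : ‖q‖ < 1) (n : ℕ) :
    (1 - ‖q‖) ^ n ≤ ‖qPoch q q n‖ := by
  rw [qPoch, norm_prod]
  calc (1 - ‖q‖) ^ n = ∏ _k ∈ range n, (1 - ‖q‖) := by simp
    _ ≤ _ := prod_le_prod (fun _ _ => (sub_pos.2 hq).le) fun k _ => one_sub_norm_le hq k

theorem eulerSeries_eq_mul {q : ℂ} (hq : ‖q‖ < 1) (a : ℂ) :
    eulerSeries a q = (1 + PowerSeries.C a * PowerSeries.X) * eulerSeries (q * a) q := by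
  ext n
  cases n with
  | zero => simp [eulerSeries, add_mul, mul_assoc]
  | succ n =>
    have h1 := qPoch_self_ne_zero hq n
    have h2 := one_sub_mul_pow_ne_zero hq n
    have h3 : (n + 1).choose 2 = n + n.choose 2 := by
      rw [Nat.choose_succ_succ' n 1, Nat.choose_one_right]
    rw [add_mul, one_mul, map_add, mul_assoc, PowerSeries.coeff_C_mul,
      PowerSeries.coeff_succ_X_mul]
    simp only [eulerSeries, PowerSeries.coeff_mk, qPoch_succ, h3]
    field_simp
    ring

theorem shiftedProd_eq_mul {r : ℕ} (a : Fin r → ℂ) {q : ℂ} (hq : ‖q‖ < 1) (s : Fin r) :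
    shiftedProd a q s =
      (1 + PowerSeries.C (a s) * PowerSeries.X) * shiftedProd a q (s + 1) := by
  unfold shiftedProd
  rw [← mul_prod_erase univ _ (mem_univ s), ← mul_prod_erase univ _ (mem_univ s), ← mul_assoc]
  congr 1
  · simpa using eulerSeries_eq_mul hq (a s)
  · refine prod_congr rfl fun t ht => ?_
    have : t.val ≠ s.val := fun h => (mem_erase.1 ht).1 (Fin.ext h)
    have : t.val < s.val ↔ t.val < s.val + 1 := by omega
    simp only [this]

theorem partialProd_succ {r : ℕ} (a : Fin r → ℂ) (x : ℂ) (s : Fin r) :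
    partialProd a x (s + 1) = (1 + a s * x) * partialProd a x s := by
  unfold partialProd
  rw [← mul_prod_erase univ _ (mem_univ s), ← mul_prod_erase univ (fun k : Fin r =>
    if k.val < s.val then 1 + a k * x else 1) (mem_univ s)]
  have : ∏ k ∈ univ.erase s, (if k.val < s.val + 1 then 1 + a k * x else 1) =
      ∏ k ∈ univ.erase s, (if k.val < s.val then 1 + a k * x else 1) := by
    refine prod_congr rfl fun t ht => ?_
    have : t.val ≠ s.val := fun h => (mem_erase.1 ht).1 (Fin.ext h)
    have : t.val < s.val ↔ t.val < s.val + 1 := by omega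
    simp only [this]
  rw [this]
  simp

theorem partialProd_eq_prod_Iio {r : ℕ} (a : Fin r → ℂ) (x : ℂ) (s : Fin r) :
    partialProd a x s = ∏ k ∈ Iio s, (1 + a k * x) := by
  rw [partialProd, prod_ite, prod_const_one, mul_one]
  exact prod_congr (by ext; simp) fun _ _ => rfl

theorem truncation_one_add_mul_X (f : PowerSeries ℂ) (a x : ℂ) (N : ℕ) :
    (1 + a * x) * ∑ m ∈ range (N + 1), PowerSeries.coeff m f * x ^ m =
      ∑ m ∈ range (N + 1),
        PowerSeries.coeff m ((1 + PowerSeries.C a * PowerSeries.X) * f) * x ^ m +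
      a * PowerSeries.coeff N f * x ^ (N + 1) := by
  induction N with
  | zero => simp; ring
  | succ N ih =>
    rw [sum_range_succ, mul_add, ih, sum_range_succ _ (N + 1)]
    have : PowerSeries.coeff (N + 1) ((1 + PowerSeries.C a * PowerSeries.X) * f) =
        PowerSeries.coeff (N + 1) f + a * PowerSeries.coeff N f := by
      rw [add_mul, one_mul, map_add, mul_assoc, PowerSeries.coeff_C_mul,
        PowerSeries.coeff_succ_X_mul]
    rw [this]
    ring

theorem sum_shiftedProd_telescope {r : ℕ} (a : Fin r → ℂ) {q : ℂ} (hq : ‖q‖ < 1) (x : ℂ)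
    (N : ℕ) :
    ∑ s : Fin r, a s * x ^ (N + 1) * partialProd a x s *
        PowerSeries.coeff N (shiftedProd a q (s + 1)) =
      partialProd a x r * ∑ m ∈ range (N + 1), PowerSeries.coeff m (shiftedProd a q r) * x ^ m -
        ∑ m ∈ range (N + 1), PowerSeries.coeff m (shiftedProd a q 0) * x ^ m := by
  let V : ℕ → ℂ := fun s =>
    partialProd a x s * ∑ m ∈ range (N + 1), PowerSeries.coeff m (shiftedProd a q s) * x ^ m
  have hV : ∀ s : Fin r, a s * x ^ (N + 1) * partialProd a x s *
      PowerSeries.coeff N (shiftedProd a q (s + 1)) = V (s + 1) - V s := fun s => by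
    simp only [V]
    have h := truncation_one_add_mul_X (shiftedProd a q (s + 1)) (a s) x N
    rw [← shiftedProd_eq_mul a hq] at h
    rw [partialProd_succ]
    linear_combination (-partialProd a x s) * h
  rw [sum_congr rfl fun s _ => hV s, Fin.sum_univ_eq_sum_range (fun s => V (s + 1) - V s) r,
    sum_range_sub]
  simp [V, partialProd]

theorem coeff_prod_antidiagonalTuple {r : ℕ} (f : Fin r → PowerSeries ℂ) (N : ℕ) :
    PowerSeries.coeff N (∏ t, f t) =
      ∑ i ∈ Nat.antidiagonalTuple r N, ∏ t, PowerSeries.coeff (i t) (f t) := by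
  rw [PowerSeries.coeff_prod]
  refine sum_nbij' (fun l => ⇑l) (fun i => Finsupp.equivFunOnFinite.symm i) ?_ ?_ ?_ ?_ ?_
  · intro l hl
    simpa [Nat.mem_antidiagonalTuple, mem_finsuppAntidiag] using hl
  · intro i hi
    simpa [Nat.mem_antidiagonalTuple, mem_finsuppAntidiag] using hi
  · intro l _
    simp
  · intro i _
    simp
  · intro l _
    rfl

theorem coeff_shiftedProd {r : ℕ} (a : Fin r → ℂ) (q : ℂ) (s N : ℕ) :
    PowerSeries.coeff N (shiftedProd a q s) =
      ∑ i ∈ Nat.antidiagonalTuple r N,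
        q ^ (∑ t with t.val < s, i t) *
          ((∏ t, a t ^ i t) * q ^ (∑ t, (i t).choose 2) / ∏ t, qPoch q q (i t)) := by
  rw [shiftedProd, coeff_prod_antidiagonalTuple]
  refine sum_congr rfl fun i _ => ?_
  rw [← prod_pow_eq_pow_sum, ← prod_pow_eq_pow_sum, prod_filter, ← prod_mul_distrib,
    ← prod_div_distrib, ← prod_mul_distrib]
  refine prod_congr rfl fun t _ => ?_
  simp only [eulerSeries, PowerSeries.coeff_mk]
  split_ifs <;> ring

theorem coeff_zero_shiftedProd {r : ℕ} (a : Fin r → ℂ) (q : ℂ) (s : ℕ) :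
    PowerSeries.coeff 0 (shiftedProd a q s) = 1 := by
  simp [coeff_shiftedProd, qPoch, Finset.Nat.antidiagonalTuple_zero_right]

theorem coeff_shiftedProd_self {r : ℕ} (a : Fin r → ℂ) (q : ℂ) (N : ℕ) :
    PowerSeries.coeff N (shiftedProd a q r) =
      q ^ N * PowerSeries.coeff N (shiftedProd a q 0) := by
  rw [coeff_shiftedProd, coeff_shiftedProd, mul_sum]
  refine sum_congr rfl fun i hi => ?_
  rw [← Nat.mem_antidiagonalTuple.1 hi]
  simp

theorem alladiTerm_eq {r : ℕ} (a : Fin r → ℂ) (q : ℂ) (N : ℕ) :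
    alladiTerm r q a N = q ^ (N ^ 2) * (∏ j : Fin r, qPoch (-a j * q) q (N - 1)) *
      (PowerSeries.coeff N (shiftedProd a q 0) +
        ∑ s : Fin r, a s * q ^ N * partialProd a (q ^ N) s *
          PowerSeries.coeff N (shiftedProd a q (s + 1))) := by
  rw [alladiTerm]
  congr 1
  simp only [coeff_shiftedProd, mul_sum]
  rw [sum_comm, ← sum_add_distrib]
  refine sum_congr rfl fun i _ => ?_
  rw [mul_add, mul_sum]
  congr 1
  · simp
  · refine sum_congr rfl fun s _ => ?_
    have : (univ.filter fun t : Fin r => t.val < s.val + 1) = Iic s := by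
      ext t
      simp
    rw [this, partialProd_eq_prod_Iio]
    ring

/-- The partial sums of the right-hand side of Alladi's identity, in closed form. -/
noncomputable def alladiPartial {r : ℕ} (a : Fin r → ℂ) (q : ℂ) (N : ℕ) : ℂ :=
  (∏ j : Fin r, qPoch (-a j * q) q N) *
    ∑ m ∈ range (N + 1), PowerSeries.coeff m (shiftedProd a q 0) * q ^ ((N + 1) * m)

theorem alladiTerm_succ {r : ℕ} (a : Fin r → ℂ) {q : ℂ} (hq : ‖q‖ < 1) (N : ℕ) :
    alladiTerm r q a (N + 1) = alladiPartial a q (N + 1) - alladiPartial a q N := by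
  have hP : ∏ j : Fin r, qPoch (-a j * q) q (N + 1) =
      (∏ j : Fin r, qPoch (-a j * q) q N) * partialProd a (q ^ (N + 1)) r := by
    rw [partialProd, ← prod_mul_distrib]
    refine prod_congr rfl fun j _ => ?_
    rw [qPoch_succ, if_pos j.isLt]
    ring
  have hT := sum_shiftedProd_telescope a hq (q ^ (N + 1)) (N + 1)
  have hS : ∑ m ∈ range (N + 1 + 1),
        PowerSeries.coeff m (shiftedProd a q r) * (q ^ (N + 1)) ^ m =
      ∑ m ∈ range (N + 1 + 1),
        PowerSeries.coeff m (shiftedProd a q 0) * q ^ ((N + 1 + 1) * m) := by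
    refine sum_congr rfl fun m _ => ?_
    rw [coeff_shiftedProd_self]
    ring
  rw [hS, sum_range_succ (fun m => PowerSeries.coeff m (shiftedProd a q 0) * (q ^ (N + 1)) ^ m)]
    at hT
  have hT' : q ^ ((N + 1) ^ 2) * ∑ s : Fin r, a s * q ^ (N + 1) * partialProd a (q ^ (N + 1)) s *
      PowerSeries.coeff (N + 1) (shiftedProd a q (s + 1)) = ∑ s : Fin r,
        a s * (q ^ (N + 1)) ^ (N + 1 + 1) * partialProd a (q ^ (N + 1)) s *
        PowerSeries.coeff (N + 1) (shiftedProd a q (s + 1)) := by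
    rw [mul_sum]
    refine sum_congr rfl fun s _ => ?_
    ring
  rw [alladiTerm_eq, alladiPartial, alladiPartial, hP, Nat.add_sub_cancel, mul_right_comm,
    mul_add, hT', hT]
  simp only [← pow_mul, sq]
  ring

theorem sum_alladiTerm {r : ℕ} (a : Fin r → ℂ) {q : ℂ} (hq : ‖q‖ < 1) (n : ℕ) :
    ∑ N ∈ range n, alladiTerm r q a (N + 1) = alladiPartial a q n - 1 := by
  simp_rw [alladiTerm_succ a hq]
  rw [sum_range_sub]
  have := coeff_zero_shiftedProd a q 0
  simp_all [alladiPartial, qPoch]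

theorem norm_coeff_mul_le {f g : PowerSeries ℂ} {A B : ℝ} (hA : 0 ≤ A) (hB : 0 ≤ B)
    (hf : ∀ n, ‖PowerSeries.coeff n f‖ ≤ A ^ n) (hg : ∀ n, ‖PowerSeries.coeff n g‖ ≤ B ^ n)
    (n : ℕ) : ‖PowerSeries.coeff n (f * g)‖ ≤ (A + B) ^ n := by
  rw [PowerSeries.coeff_mul, (Commute.all A B).add_pow']
  refine (norm_sum_le _ _).trans (sum_le_sum fun p hp => ?_)
  have h1 : 1 ≤ n.choose p.1 := Nat.choose_pos (by have := mem_antidiagonal.1 hp; omega)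
  have h2 : 0 ≤ A ^ p.1 * B ^ p.2 := by positivity
  rw [norm_mul, nsmul_eq_mul]
  calc _ ≤ A ^ p.1 * B ^ p.2 := by gcongr; exacts [hf _, hg _]
    _ ≤ _ := le_mul_of_one_le_left h2 (by exact_mod_cast h1)

theorem norm_coeff_prod_le {ι : Type*} (s : Finset ι) {f : ι → PowerSeries ℂ} {A : ι → ℝ}
    (hA : ∀ t, 0 ≤ A t) (hf : ∀ t n, ‖PowerSeries.coeff n (f t)‖ ≤ A t ^ n) (n : ℕ) :
    ‖PowerSeries.coeff n (∏ t ∈ s, f t)‖ ≤ (∑ t ∈ s, A t) ^ n := by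
  classical
  induction s using Finset.induction_on generalizing n with
  | empty =>
    rw [prod_empty, sum_empty, PowerSeries.coeff_one]
    split_ifs with h <;> simp [h]
  | insert t s ht ih =>
    rw [prod_insert ht, sum_insert ht]
    exact norm_coeff_mul_le (hA t) (sum_nonneg fun t _ => hA t) (hf t) ih n

theorem norm_coeff_eulerSeries_le {q : ℂ} (hq : ‖q‖ < 1) (a : ℂ) (n : ℕ) :
    ‖PowerSeries.coeff n (eulerSeries a q)‖ ≤ (‖a‖ / (1 - ‖q‖)) ^ n := by
  rw [eulerSeries, PowerSeries.coeff_mk, norm_div, norm_mul, norm_pow, norm_pow, div_pow]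
  have h1 := pow_le_norm_qPoch_self hq n
  have h2 : 0 < (1 - ‖q‖) ^ n := pow_pos (sub_pos.2 hq) n
  gcongr
  exact mul_le_of_le_one_right (by positivity) (pow_le_one₀ (norm_nonneg q) hq.le)

theorem norm_coeff_shiftedProd_le {r : ℕ} (a : Fin r → ℂ) {q : ℂ} (hq : ‖q‖ < 1) (s n : ℕ) :
    ‖PowerSeries.coeff n (shiftedProd a q s)‖ ≤ (∑ t, ‖a t‖ / (1 - ‖q‖)) ^ n := by
  have hK : 0 < 1 - ‖q‖ := sub_pos.2 hq
  refine norm_coeff_prod_le univ (A := fun t => ‖a t‖ / (1 - ‖q‖)) (fun t => by positivity)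
    (fun t m => (norm_coeff_eulerSeries_le hq _ m).trans ?_) n
  gcongr
  split_ifs
  · rw [norm_mul]
    exact mul_le_of_le_one_left (norm_nonneg _) hq.le
  · exact le_rfl

theorem tendsto_qPoch (a : ℂ) {q : ℂ} (hq : ‖q‖ < 1) :
    Tendsto (fun n => qPoch a q n) atTop (𝓝 (qPochInf a q)) := by
  have hs : Summable fun k : ℕ => ‖-(a * q ^ k)‖ := by
    simp only [norm_neg, norm_mul, norm_pow]
    exact (summable_geometric_of_lt_one (norm_nonneg q) hq).mul_left _
  have hm : Multipliable fun k : ℕ => (1 - a * q ^ k) := by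
    simpa only [sub_eq_add_neg] using multipliable_one_add_of_summable hs
  exact hm.hasProd.tendsto_prod_nat

theorem tendsto_prod_qPoch {r : ℕ} (a : Fin r → ℂ) {q : ℂ} (hq : ‖q‖ < 1) :
    Tendsto (fun n => ∏ j, qPoch (-a j * q) q n) atTop (𝓝 (∏ j, qPochInf (-a j * q) q)) :=
  tendsto_finsetProd _ fun _ _ => tendsto_qPoch _ hq

theorem tendsto_mul_norm_pow (L : ℝ) {q : ℂ} (hq : ‖q‖ < 1) :
    Tendsto (fun n : ℕ => L * ‖q‖ ^ (n + 1)) atTop (𝓝 0) := by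
  simpa using ((tendsto_pow_atTop_nhds_zero_of_lt_one (norm_nonneg q) hq).comp
    (tendsto_add_atTop_nat 1)).const_mul L

theorem tendsto_alladiPartial {r : ℕ} (a : Fin r → ℂ) {q : ℂ} (hq : ‖q‖ < 1) :
    Tendsto (alladiPartial a q) atTop (𝓝 (∏ j, qPochInf (-a j * q) q)) := by
  set L : ℝ := ∑ t, ‖a t‖ / (1 - ‖q‖) with hL
  have hK : 0 < 1 - ‖q‖ := sub_pos.2 hq
  have hL0 : 0 ≤ L := sum_nonneg fun t _ => by positivity
  have hy := tendsto_mul_norm_pow L hq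
  have hlim : Tendsto (fun n : ℕ => ∑ m ∈ range (n + 1),
      PowerSeries.coeff m (shiftedProd a q 0) * q ^ ((n + 1) * m)) atTop (𝓝 1) := by
    rw [tendsto_iff_norm_sub_tendsto_zero]
    have hy2 : Tendsto (fun n : ℕ => L * ‖q‖ ^ (n + 1) * 2) atTop (𝓝 0) := by
      simpa using hy.mul_const 2
    refine squeeze_zero' (Eventually.of_forall fun _ => norm_nonneg _) ?_ hy2
    filter_upwards [hy.eventually_le_const (show (0 : ℝ) < 1 / 2 by norm_num)] with n hn
    set y := L * ‖q‖ ^ (n + 1) with hydef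
    have hy0 : 0 ≤ y := by positivity
    rw [sum_range_succ', coeff_zero_shiftedProd, mul_zero, pow_zero, mul_one, add_sub_cancel_right]
    calc _ ≤ ∑ m ∈ range n, y * (1 / 2 : ℝ) ^ m := by
          refine (norm_sum_le _ _).trans (sum_le_sum fun m _ => ?_)
          calc _ ≤ L ^ (m + 1) * ‖q‖ ^ ((n + 1) * (m + 1)) := by
                rw [norm_mul, norm_pow]
                gcongr
                exact norm_coeff_shiftedProd_le a hq 0 (m + 1)
            _ = y * y ^ m := by rw [hydef]; ring
            _ ≤ _ := by gcongr
      _ ≤ y * 2 := by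
          rw [← mul_sum]
          gcongr
          exact sum_geometric_two_le n
  have := (tendsto_prod_qPoch a hq).mul hlim
  rwa [mul_one] at this

theorem norm_partialProd_le {r : ℕ} (a : Fin r → ℂ) {x : ℂ} (hx : ‖x‖ ≤ 1) (s : ℕ) :
    ‖partialProd a x s‖ ≤ ∏ k, (1 + ‖a k‖) := by
  rw [partialProd, norm_prod]
  refine prod_le_prod (fun _ _ => norm_nonneg _) fun k _ => ?_
  split_ifs
  · refine (norm_add_le _ _).trans ?_
    rw [norm_one, norm_mul]
    gcongr
    exact mul_le_of_le_one_right (norm_nonneg _) hx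
  · simp

theorem summable_pow_sq_mul_pow (L : ℝ) (hL : 0 ≤ L) {q : ℂ} (hq : ‖q‖ < 1) :
    Summable fun N : ℕ => ‖q‖ ^ ((N + 1) ^ 2) * L ^ (N + 1) := by
  have hy := tendsto_mul_norm_pow L hq
  refine Summable.of_norm_bounded_eventually_nat
    ((summable_nat_add_iff 1).2 summable_geometric_two) ?_
  filter_upwards [hy.eventually_le_const (show (0 : ℝ) < 1 / 2 by norm_num)] with n hn
  rw [Real.norm_of_nonneg (by positivity)]
  calc _ = (L * ‖q‖ ^ (n + 1)) ^ (n + 1) := by ring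
    _ ≤ _ := by gcongr

theorem summable_norm_alladiTerm {r : ℕ} (a : Fin r → ℂ) {q : ℂ} (hq : ‖q‖ < 1) :
    Summable fun N : ℕ => ‖alladiTerm r q a (N + 1)‖ := by
  set L : ℝ := ∑ t, ‖a t‖ / (1 - ‖q‖) with hL
  have hK : 0 < 1 - ‖q‖ := sub_pos.2 hq
  have hL0 : 0 ≤ L := sum_nonneg fun t _ => by positivity
  obtain ⟨D, hD⟩ := (tendsto_prod_qPoch a hq).norm.bddAbove_range
  have hD' : ∀ n, ‖∏ j, qPoch (-a j * q) q n‖ ≤ D := fun n => hD ⟨n, rfl⟩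
  set M : ℝ := ∏ k, (1 + ‖a k‖) with hM
  refine Summable.of_nonneg_of_le (fun _ => norm_nonneg _) (fun N => ?_)
    ((summable_pow_sq_mul_pow L hL0 hq).mul_left (D * (1 + ∑ s, ‖a s‖ * M)))
  have hx : ‖q ^ (N + 1)‖ ≤ 1 := by
    rw [norm_pow]
    exact pow_le_one₀ (norm_nonneg q) hq.le
  have hM0 : 0 ≤ M := prod_nonneg fun k _ => by positivity
  have hD0 : 0 ≤ D := (norm_nonneg _).trans (hD' 0)
  have hsum : ‖PowerSeries.coeff (N + 1) (shiftedProd a q 0) +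
      ∑ s : Fin r, a s * q ^ (N + 1) * partialProd a (q ^ (N + 1)) s *
        PowerSeries.coeff (N + 1) (shiftedProd a q (s + 1))‖ ≤
      (1 + ∑ s, ‖a s‖ * M) * L ^ (N + 1) := by
    rw [add_mul, one_mul, sum_mul]
    refine (norm_add_le _ _).trans (add_le_add (norm_coeff_shiftedProd_le a hq _ _)
      ((norm_sum_le _ _).trans (sum_le_sum fun s _ => ?_)))
    rw [norm_mul, norm_mul, norm_mul]
    gcongr
    · exact mul_le_of_le_one_right (norm_nonneg _) hx
    · exact norm_partialProd_le a hx s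
    · exact norm_coeff_shiftedProd_le a hq _ _
  rw [alladiTerm_eq, norm_mul, norm_mul, norm_pow, Nat.add_sub_cancel]
  calc _ ≤ ‖q‖ ^ ((N + 1) ^ 2) * D * ((1 + ∑ s, ‖a s‖ * M) * L ^ (N + 1)) := by
        gcongr
        exact hD' N
    _ = _ := by ring

/-- Alladi's multi-dimensional generalization of Sylvester's identity (Theorem 1.1). -/
theorem alladi_multidimensional_sylvester (r : ℕ) (hr : 1 ≤ r) (q : ℂ) (hq : ‖q‖ < 1)
    (a : Fin r → ℂ) :
    Summable (fun N : ℕ => ‖alladiTerm r q a (N + 1)‖) ∧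
    (∏ j : Fin r, qPochInf (-a j * q) q) = 1 + ∑' N : ℕ, alladiTerm r q a (N + 1) := by
  have hs := summable_norm_alladiTerm a hq
  refine ⟨hs, ?_⟩
  have h1 := hs.of_norm.hasSum.tendsto_sum_nat
  simp_rw [sum_alladiTerm a hq] at h1
  rw [tendsto_nhds_unique h1 ((tendsto_alladiPartial a hq).sub_const 1)]
  ring
end
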